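/- The normalization constant of the GOE-type measure: for N ∈ ℕ, ∫_{W_N^A} e^{−|x|²/2} ∏_{1 ≤ j < k ≤ N} (x_k − x_j) dx = C_N^{(1)}, where W_N^A = {x ∈ ℝ^N : x_1 < ⋯ < x_N} and C_N^{(1)} = ((2π)^{N/2}/N!) ∏_{j=1}^N Γ(j/2 + 1)/Γ(3/2). Equivalently, the density μ_{N,1}^{(1)} integrates to 1 over W_N^A. -/

import Mathlib

open Real MeasureTheory Finset

/-- The Weyl chamber `W_N^A = {x : x_1 < x_2 < ⋯ < x_N}`. -/
def weylChamber (N : ℕ) : Set (Fin N → ℝ) := {x | StrictMono x}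

/-- The GOE normalization constant `C_N^{(1)} = ((2π)^{N/2}/N!) ∏_{j=1}^N Γ(j/2+1)/Γ(3/2)`. -/
noncomputable def goeConst (N : ℕ) : ℝ :=
  (2 * π) ^ ((N : ℝ) / 2) / (N.factorial : ℝ) *
    ∏ j ∈ Finset.range N, Real.Gamma (((j : ℝ) + 1) / 2 + 1) / Real.Gamma (3 / 2)

/-- The sign of a real number as a monoid homomorphism. -/
noncomputable def realSignHom : ℝ →* ℝ where
  toFun := Real.sign
  map_one' := Real.sign_one
  map_mul' x y := by
    rcases lt_trichotomy x 0 with hx | rfl | hx <;> rcases lt_trichotomy y 0 with hy | rfl | hy <;>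
      simp [Real.sign_of_pos, Real.sign_of_neg, mul_pos_of_neg_of_neg, mul_neg_of_neg_of_pos,
        mul_neg_of_pos_of_neg, *]

@[simp]
theorem realSignHom_apply (x : ℝ) : realSignHom x = Real.sign x := rfl

theorem Real.measurable_sign : Measurable Real.sign := by
  unfold Real.sign
  exact Measurable.ite measurableSet_Iio measurable_const
    (Measurable.ite measurableSet_Ioi measurable_const measurable_const)

theorem Real.abs_sign_le_one (x : ℝ) : |Real.sign x| ≤ 1 := by
  rcases Real.sign_apply_eq x with h | h | h <;> simp [h]

/-- The sign `∏_{j<k} sgn (x_k - x_j)` of the Vandermonde determinant of `x`. -/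
noncomputable def vandermondeSign {n : ℕ} (x : Fin n → ℝ) : ℝ :=
  ∏ j : Fin n, ∏ k ∈ Finset.Ioi j, Real.sign (x k - x j)

theorem vandermondeSign_eq_sign_det {n : ℕ} (x : Fin n → ℝ) :
    vandermondeSign x = Real.sign (Matrix.vandermonde x).det := by
  rw [Matrix.det_vandermonde, ← realSignHom_apply, map_prod]
  simp [vandermondeSign, map_prod]

theorem vandermondeSign_comp_perm {n : ℕ} (x : Fin n → ℝ) (σ : Equiv.Perm (Fin n)) :
    vandermondeSign (x ∘ σ) = (Equiv.Perm.sign σ : ℤ) * vandermondeSign x := by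
  have h : Matrix.vandermonde (x ∘ σ) = (Matrix.vandermonde x).submatrix σ id := by
    ext i j; simp [Matrix.vandermonde_apply]
  rw [vandermondeSign_eq_sign_det, vandermondeSign_eq_sign_det, h, Matrix.det_permute,
    ← realSignHom_apply, map_mul, realSignHom_apply, realSignHom_apply]
  rcases Int.units_eq_one_or (Equiv.Perm.sign σ) with h | h <;> simp [h, Real.sign_neg]

theorem vandermondeSign_of_strictMono {n : ℕ} {x : Fin n → ℝ} (hx : StrictMono x) :
    vandermondeSign x = 1 :=
  Finset.prod_eq_one fun _ _ => Finset.prod_eq_one fun _ hk =>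
    Real.sign_of_pos (sub_pos.2 (hx (Finset.mem_Ioi.1 hk)))

theorem vandermondeSign_of_not_injective {n : ℕ} {x : Fin n → ℝ} (hx : ¬ Function.Injective x) :
    vandermondeSign x = 0 := by
  rw [vandermondeSign_eq_sign_det, Real.sign_eq_zero_iff, Matrix.det_vandermonde_eq_zero_iff]
  simpa [Function.Injective] using hx

theorem vandermondeSign_insertNth {n : ℕ} (p : Fin (n + 1)) (t : ℝ) (z : Fin n → ℝ) :
    vandermondeSign (p.insertNth t z : Fin (n + 1) → ℝ) =
      (-1) ^ (p : ℕ) * (∏ k, Real.sign (z k - t)) * vandermondeSign z := by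
  have h := vandermondeSign_comp_perm (p.insertNth t z : Fin (n + 1) → ℝ) p.cycleRange.symm
  rw [Fin.insertNth_comp_cycleRange_symm, Equiv.Perm.sign_symm, Fin.sign_cycleRange] at h
  have h0 : vandermondeSign (Fin.cons t z : Fin (n + 1) → ℝ) =
      (∏ k, Real.sign (z k - t)) * vandermondeSign z := by
    simp [vandermondeSign, Fin.prod_univ_succ]
  rw [h0] at h
  rw [mul_assoc, h]
  push_cast
  rw [← mul_assoc, ← mul_pow]
  simp

theorem measurable_vandermondeSign {n : ℕ} :
    Measurable (vandermondeSign : (Fin n → ℝ) → ℝ) := by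
  unfold vandermondeSign
  refine Finset.measurable_prod _ fun j _ => Finset.measurable_prod _ fun k _ => ?_
  exact Real.measurable_sign.comp ((measurable_pi_apply k).sub (measurable_pi_apply j))

theorem abs_prod_sign_le_one {ι : Type*} (s : Finset ι) (f : ι → ℝ) :
    |∏ k ∈ s, Real.sign (f k)| ≤ 1 := by
  rw [Finset.abs_prod]
  exact Finset.prod_le_one (fun _ _ => abs_nonneg _) fun _ _ => Real.abs_sign_le_one _

theorem abs_vandermondeSign_le_one {n : ℕ} (x : Fin n → ℝ) : |vandermondeSign x| ≤ 1 := by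
  rw [vandermondeSign_eq_sign_det]
  exact Real.abs_sign_le_one _

theorem measurableSet_weylChamber (n : ℕ) : MeasurableSet (weylChamber n) := by
  have : weylChamber n = ⋂ i : Fin n, ⋂ j : Fin n, {x | i < j → x i < x j} := by
    ext x; simp [weylChamber, StrictMono]
  rw [this]
  refine MeasurableSet.iInter fun i => MeasurableSet.iInter fun j => ?_
  by_cases h : i < j
  · simpa [h] using measurableSet_lt (measurable_pi_apply i) (measurable_pi_apply j)
  · simp [h]

theorem sum_sign_indicator_weylChamber {n : ℕ} (x : Fin n → ℝ) :
    ∑ σ : Equiv.Perm (Fin n), ((Equiv.Perm.sign σ : ℤ) : ℝ) *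
      (weylChamber n).indicator 1 (x ∘ σ) = vandermondeSign x := by
  by_cases hx : Function.Injective x
  · have hsort : StrictMono (x ∘ Tuple.sort x) :=
      (Tuple.monotone_sort x).strictMono_of_injective (hx.comp (Tuple.sort x).injective)
    rw [Finset.sum_eq_single (Tuple.sort x)]
    · have h1 := vandermondeSign_comp_perm x (Tuple.sort x)
      rw [vandermondeSign_of_strictMono hsort] at h1
      rw [Set.indicator_of_mem (show x ∘ Tuple.sort x ∈ weylChamber n from hsort), Pi.one_apply,
        h1, ← mul_assoc, ← Int.cast_mul, ← Units.val_mul, Int.units_mul_self]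
      simp
    · intro σ _ hσ
      rw [Set.indicator_of_notMem, mul_zero]
      intro hmem
      have hmono : StrictMono (x ∘ σ) := hmem
      have := Tuple.unique_monotone hmono.monotone hsort.monotone
      exact hσ (Equiv.ext fun i => hx (congrFun this i))
    · simp
  · rw [vandermondeSign_of_not_injective hx]
    refine Finset.sum_eq_zero fun σ _ => ?_
    rw [Set.indicator_of_notMem, mul_zero]
    intro hmem
    have hmono : StrictMono (x ∘ σ) := hmem
    apply hx
    have := hmono.injective.comp σ.symm.injective
    simpa [Function.comp_assoc] using this

theorem coe_piCongrLeft_symm_eq_comp {n : ℕ} (σ : Equiv.Perm (Fin n)) :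
    ⇑(MeasurableEquiv.piCongrLeft (fun _ : Fin n => ℝ) σ.symm) = fun x => x ∘ σ := by
  ext x i
  rw [MeasurableEquiv.coe_piCongrLeft]
  simpa using Equiv.piCongrLeft_apply_apply (fun _ : Fin n => ℝ) σ.symm x (σ i)

theorem setIntegral_weylChamber_det {n : ℕ} (f : Fin n → ℝ → ℝ)
    (hf : ∀ i, Integrable (f i)) :
    ∫ x in weylChamber n, (Matrix.of fun i j => f i (x j)).det =
      ∫ x, vandermondeSign x * ∏ i, f i (x i) := by
  have hprod : Integrable (fun x : Fin n → ℝ => ∏ i, f i (x i)) := Integrable.fintype_prod hf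
  have hpres (σ : Equiv.Perm (Fin n)) :
      MeasurePreserving (fun x : Fin n → ℝ => x ∘ σ) volume volume :=
    coe_piCongrLeft_symm_eq_comp σ ▸
      volume_measurePreserving_piCongrLeft (fun _ : Fin n => ℝ) σ.symm
  have hemb (σ : Equiv.Perm (Fin n)) : MeasurableEmbedding (fun x : Fin n → ℝ => x ∘ σ) :=
    coe_piCongrLeft_symm_eq_comp σ ▸ MeasurableEquiv.measurableEmbedding _
  have hint (σ : Equiv.Perm (Fin n)) :
      Integrable (fun x : Fin n → ℝ => ∏ i, f i (x (σ⁻¹ i))) :=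
    ((hpres σ).integrable_comp_emb (hemb σ)).1 <| by simpa [Function.comp_def] using hprod
  have hdet (x : Fin n → ℝ) : (Matrix.of fun i j => f i (x j)).det =
      ∑ σ : Equiv.Perm (Fin n), ((Equiv.Perm.sign σ : ℤ) : ℝ) * ∏ i, f i (x (σ⁻¹ i)) := by
    rw [Matrix.det_apply']
    refine Finset.sum_congr rfl fun σ _ => ?_
    congr 1
    rw [← Equiv.prod_comp σ (fun i => f i (x (σ⁻¹ i)))]
    simp
  simp_rw [hdet, ← sum_sign_indicator_weylChamber, Finset.sum_mul]
  rw [integral_finsetSum _ fun σ _ => ((hint σ).const_mul _).integrableOn,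
    integral_finsetSum]
  · refine Finset.sum_congr rfl fun σ _ => ?_
    rw [← integral_indicator (measurableSet_weylChamber n),
      ← (hpres σ).integral_comp (hemb σ)]
    refine integral_congr_ae (.of_forall fun x => ?_)
    by_cases hx : x ∘ σ ∈ weylChamber n <;> simp [hx]
  · intro σ _
    have h := (hprod.indicator ((hpres σ).measurable (measurableSet_weylChamber n))).const_mul
      ((Equiv.Perm.sign σ : ℤ) : ℝ)
    convert h using 2 with x
    by_cases hx : x ∘ σ ∈ weylChamber n <;> simp [hx]

theorem integral_vandermondeSign_mul {n : ℕ} (p : Fin (n + 1)) (G : ℝ → (Fin n → ℝ) → ℝ)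
    (hG : Integrable (fun q : ℝ × (Fin n → ℝ) => G q.1 q.2) (volume.prod volume)) :
    ∫ x : Fin (n + 1) → ℝ, vandermondeSign x * G (x p) (fun k => x (p.succAbove k)) =
      (-1) ^ (p : ℕ) * ∫ z, vandermondeSign z * ∫ t, (∏ k, Real.sign (z k - t)) * G t z := by
  have hpres := (volume_preserving_piFinSuccAbove (fun _ : Fin (n + 1) => ℝ) p).symm
  have hint : Integrable (fun q : ℝ × (Fin n → ℝ) =>
      ((∏ k, Real.sign (q.2 k - q.1)) * vandermondeSign q.2) * G q.1 q.2)
      (volume.prod volume) := by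
    refine hG.bdd_mul (c := 1) ?_ (.of_forall fun q => ?_)
    · refine Measurable.aestronglyMeasurable (Measurable.mul ?_ ?_)
      · exact Finset.measurable_prod _ fun k _ => Real.measurable_sign.comp (by fun_prop)
      · exact measurable_vandermondeSign.comp measurable_snd
    · rw [Real.norm_eq_abs, abs_mul]
      exact mul_le_one₀ (abs_prod_sign_le_one _ _) (abs_nonneg _) (abs_vandermondeSign_le_one _)
  rw [← hpres.integral_comp' (g := fun x : Fin (n + 1) → ℝ =>
    vandermondeSign x * G (x p) (fun k => x (p.succAbove k))), Measure.volume_eq_prod]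
  have hcongr (q : ℝ × (Fin n → ℝ)) :
      vandermondeSign ((MeasurableEquiv.piFinSuccAbove (fun _ => ℝ) p).symm q) *
        G ((MeasurableEquiv.piFinSuccAbove (fun _ => ℝ) p).symm q p)
          (fun k => (MeasurableEquiv.piFinSuccAbove (fun _ => ℝ) p).symm q (p.succAbove k)) =
      (-1) ^ (p : ℕ) * (((∏ k, Real.sign (q.2 k - q.1)) * vandermondeSign q.2) * G q.1 q.2) := by
    have : (MeasurableEquiv.piFinSuccAbove (fun _ => ℝ) p).symm q = p.insertNth q.1 q.2 := rfl
    rw [this, vandermondeSign_insertNth]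
    simp only [Fin.insertNth_apply_same, Fin.insertNth_apply_succAbove]
    ring
  simp_rw [hcongr]
  rw [integral_const_mul, integral_prod_symm _ hint]
  simp_rw [← integral_const_mul]
  congr! 4
  ring

theorem integral_Ioi_deriv_eq_neg {g g' : ℝ → ℝ} (hg : ∀ t, HasDerivAt g (g' t) t)
    (hgi : Integrable g) (hgi' : Integrable g') (a : ℝ) : ∫ t in Set.Ioi a, g' t = -g a := by
  rw [integral_Ioi_of_hasDerivAt_of_tendsto' (fun t _ => hg t) hgi'.integrableOn
    (tendsto_zero_of_hasDerivAt_of_integrableOn_Ioi (a := a) (fun t _ => hg t)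
      hgi'.integrableOn hgi.integrableOn), zero_sub]

theorem integral_prod_sign_mul_deriv {ι : Type*} [DecidableEq ι] {z : ι → ℝ}
    (hz : Function.Injective z) {g g' : ℝ → ℝ} (hg : ∀ t, HasDerivAt g (g' t) t)
    (hgi : Integrable g) (hgi' : Integrable g') (s : Finset ι) :
    ∫ t, (∏ k ∈ s, Real.sign (z k - t)) * g' t =
      2 * ∑ i ∈ s, g (z i) * ∏ k ∈ s.erase i, Real.sign (z k - z i) := by
  induction s using Finset.induction_on_max_value z with
  | empty => simpa using integral_eq_zero_of_hasDerivAt_of_integrable hg hgi' hgi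
  | insert a s ha hmax ih =>
    have hlt : ∀ k ∈ s, z k < z a := fun k hk =>
      lt_of_le_of_ne (hmax k hk) fun h => ha (hz h ▸ hk)
    have hint (s : Finset ι) : Integrable (fun t => (∏ k ∈ s, Real.sign (z k - t)) * g' t) := by
      refine hgi'.bdd_mul (c := 1) ?_ (.of_forall fun t => abs_prod_sign_le_one _ _)
      exact (Finset.measurable_prod _ fun k _ =>
        Real.measurable_sign.comp (by fun_prop)).aestronglyMeasurable
    have hlast : ∏ k ∈ s, Real.sign (z k - z a) = (-1) ^ #s := by
      rw [Finset.prod_congr rfl fun k hk => Real.sign_of_neg (sub_neg.2 (hlt k hk)),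
        Finset.prod_const]
    have hsplit : (fun t => (∏ k ∈ insert a s, Real.sign (z k - t)) * g' t) =ᵐ[volume]
        fun t => (∏ k ∈ s, Real.sign (z k - t)) * g' t +
          (Set.Ioi (z a)).indicator (fun t => (-2 * (-1) ^ #s) * g' t) t := by
      filter_upwards [compl_mem_ae_iff.2 (measure_singleton (z a))] with t ht
      rw [Finset.prod_insert ha]
      rcases lt_or_gt_of_ne (show t ≠ z a from ht) with h | h
      · rw [Real.sign_of_pos (sub_pos.2 h), Set.indicator_of_notMem (by simpa using h.le)]
        ring
      · rw [Real.sign_of_neg (sub_neg.2 h), Set.indicator_of_mem (by simpa using h),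
          Finset.prod_congr rfl fun k hk => Real.sign_of_neg (sub_neg.2 ((hlt k hk).trans h)),
          Finset.prod_const]
        ring
    rw [integral_congr_ae hsplit, integral_add (hint s)
      ((hgi'.const_mul _).indicator measurableSet_Ioi), ih, integral_indicator measurableSet_Ioi,
      integral_const_mul, integral_Ioi_deriv_eq_neg hg hgi hgi', Finset.sum_insert ha,
      Finset.erase_insert ha, hlast]
    have : ∀ i ∈ s, g (z i) * ∏ k ∈ (insert a s).erase i, Real.sign (z k - z i) =
        g (z i) * ∏ k ∈ s.erase i, Real.sign (z k - z i) := fun i hi => by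
      rw [Finset.erase_insert_of_ne (ne_of_mem_of_not_mem hi ha).symm,
        Finset.prod_insert (fun h => ha (Finset.mem_of_mem_erase h)),
        Real.sign_of_pos (sub_pos.2 (hlt i hi)), one_mul]
    rw [Finset.sum_congr rfl this]
    ring

theorem integral_vandermondeSign_mul_prod_deriv {m : ℕ} (f : Fin (m + 1) → ℝ → ℝ)
    {g g' : ℝ → ℝ} (hf : ∀ i, Integrable (f i)) (hg : ∀ t, HasDerivAt g (g' t) t)
    (hgi : Integrable g) (hgi' : Integrable g') (hgf : ∀ i, Integrable fun t => g t * f i t) :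
    ∫ x : Fin (m + 2) → ℝ, vandermondeSign x *
        (g' (x (Fin.last _)) * ∏ i : Fin (m + 1), f i (x i.castSucc)) =
      2 * (-1) ^ (m + 1) * ∑ i : Fin (m + 1), (-1) ^ (i : ℕ) * (∫ t, g t * f i t) *
        ∫ x : Fin m → ℝ, vandermondeSign x * ∏ k, f (i.succAbove k) (x k) := by
  have hprod : Integrable (fun z : Fin (m + 1) → ℝ => ∏ i, f i (z i)) := Integrable.fintype_prod hf
  have h1 := integral_vandermondeSign_mul (Fin.last (m + 1))
    (fun t z => g' t * ∏ i, f i (z i)) (hgi'.mul_prod hprod)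
  simp only [Fin.succAbove_last, Fin.val_last] at h1
  rw [h1]
  have hGi (i : Fin (m + 1)) : Integrable (fun q : ℝ × (Fin m → ℝ) =>
      (∏ k, Real.sign (q.2 k - q.1)) * ((g q.1 * f i q.1) * ∏ k, f (i.succAbove k) (q.2 k)))
      (volume.prod volume) := by
    refine Integrable.bdd_mul (c := 1) ?_ ?_ (.of_forall fun q => abs_prod_sign_le_one _ _)
    · exact (hgf i).mul_prod (Integrable.fintype_prod fun k => hf (i.succAbove k))
    · exact (Finset.measurable_prod _ fun k _ =>
        Real.measurable_sign.comp (by fun_prop)).aestronglyMeasurable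
  have hcongr (z : Fin (m + 1) → ℝ) :
      vandermondeSign z * ∫ t, (∏ k, Real.sign (z k - t)) * (g' t * ∏ i, f i (z i)) =
      ∑ i : Fin (m + 1), 2 * (vandermondeSign z *
        ((∏ k : Fin m, Real.sign (z (i.succAbove k) - z i)) * ((g (z i) * f i (z i)) *
          ∏ k, f (i.succAbove k) (z (i.succAbove k))))) := by
    by_cases hz : Function.Injective z
    · simp_rw [← mul_assoc (∏ k, Real.sign (z k - _)) (g' _)]
      rw [integral_mul_const, integral_prod_sign_mul_deriv hz hg hgi hgi', Finset.mul_sum,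
        Finset.sum_mul, Finset.mul_sum]
      refine Finset.sum_congr rfl fun i _ => ?_
      have h2 : ∏ k ∈ Finset.univ.erase i, Real.sign (z k - z i) =
          ∏ k : Fin m, Real.sign (z (i.succAbove k) - z i) := by
        have : Finset.univ.erase i = Finset.univ.map i.succAboveEmb := by
          ext k
          simp [Fin.exists_succAbove_eq_iff]
        rw [this, Finset.prod_map]
        rfl
      rw [h2, Fin.prod_univ_succAbove (fun i => f i (z i)) i]
      ring
    · simp [vandermondeSign_of_not_injective hz]
  simp_rw [hcongr]
  rw [integral_finsetSum]
  · rw [mul_comm (2 : ℝ), mul_assoc, Finset.mul_sum Finset.univ _ (2 : ℝ)]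
    congr 1
    refine Finset.sum_congr rfl fun i _ => ?_
    rw [integral_const_mul, integral_vandermondeSign_mul i (fun t u =>
      (∏ k, Real.sign (u k - t)) * ((g t * f i t) * ∏ k, f (i.succAbove k) (u k))) (hGi i)]
    rw [mul_assoc, ← integral_const_mul (∫ t, g t * f i t)]
    congr 2
    refine integral_congr_ae (.of_forall fun u => ?_)
    have hae : (fun t => (∏ k, Real.sign (u k - t)) * ((∏ k, Real.sign (u k - t)) *
        ((g t * f i t) * ∏ k, f (i.succAbove k) (u k)))) =ᵐ[volume]
        fun t => (g t * f i t) * ∏ k, f (i.succAbove k) (u k) := by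
      filter_upwards [compl_mem_ae_iff.2 ((Set.finite_range u).measure_zero volume)] with t ht
      rw [← mul_assoc, ← Finset.prod_mul_distrib, Finset.prod_eq_one, one_mul]
      intro k _
      have : u k - t ≠ 0 := fun h => ht ⟨k, sub_eq_zero.1 h⟩
      rcases Real.sign_apply_eq_of_ne_zero _ this with h | h <;> simp [h]
    simp only
    rw [integral_congr_ae hae, integral_mul_const]
    ring
  · intro i _
    refine Integrable.const_mul ?_ 2
    refine Integrable.bdd_mul (c := 1) ?_ measurable_vandermondeSign.aestronglyMeasurable
      (.of_forall abs_vandermondeSign_le_one)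
    have hpres := volume_preserving_piFinSuccAbove (fun _ : Fin (m + 1) => ℝ) i
    exact hpres.integrable_comp_of_integrable (hGi i)

open Polynomial in
/-- The monic orthogonal polynomials for the weight `exp (-t ^ 2)`. -/
noncomputable def monicHermite : ℕ → ℝ[X]
  | 0 => 1
  | n + 1 => X * monicHermite n - C (1 / 2) * derivative (monicHermite n)

namespace Polynomial

theorem Monic.X_mul_sub_C_mul_derivative {p : ℝ[X]} (hp : p.Monic) (c : ℝ) :
    (X * p - C c * derivative p).Monic ∧
      (X * p - C c * derivative p).natDegree = p.natDegree + 1 := by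
  have hX : (X * p).Monic := monic_X.mul hp
  have hd : (C c * derivative p).degree < (X * p).degree := by
    refine lt_of_le_of_lt (smul_eq_C_mul c ▸ (degree_smul_le c _).trans degree_derivative_le) ?_
    rw [Polynomial.degree_mul, degree_X, degree_eq_natDegree hp.ne_zero]
    exact_mod_cast (by omega : p.natDegree < 1 + p.natDegree)
  refine ⟨hX.sub_of_left hd, ?_⟩
  rw [natDegree_eq_of_degree_eq (degree_sub_eq_left_of_degree_lt hd), natDegree_X_mul hp.ne_zero]

theorem monic_monicHermite_and_natDegree (n : ℕ) :
    (monicHermite n).Monic ∧ (monicHermite n).natDegree = n := by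
  induction n with
  | zero => simp [monicHermite]
  | succ n ih =>
    have h := ih.1.X_mul_sub_C_mul_derivative (1 / 2)
    rw [ih.2] at h
    exact h

theorem integrable_eval_mul_exp_neg_mul_sq (p : ℝ[X]) {b : ℝ} (hb : 0 < b) :
    Integrable fun t => p.eval t * Real.exp (-b * t ^ 2) := by
  induction p using Polynomial.induction_on' with
  | add p q hp hq =>
    simp_rw [eval_add, add_mul]
    exact hp.add hq
  | monomial n a =>
    have h := (integrable_rpow_mul_exp_neg_mul_sq hb (s := n)
      (by linarith [n.cast_nonneg (α := ℝ)])).const_mul a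
    simpa [mul_assoc] using h

theorem hasDerivAt_eval_mul_exp_neg_mul_sq (p : ℝ[X]) (b t : ℝ) :
    HasDerivAt (fun t => p.eval t * Real.exp (-b * t ^ 2))
      ((derivative p - C (2 * b) * X * p).eval t * Real.exp (-b * t ^ 2)) t := by
  have h := (p.hasDerivAt t).mul (((hasDerivAt_pow 2 t).const_mul (-b)).exp)
  refine h.congr_deriv ?_
  simp
  ring

theorem integral_monicHermite_mul (n : ℕ) (q : ℝ[X]) :
    ∫ t, (monicHermite n * q).eval t * Real.exp (-1 * t ^ 2) =
      (1 / 2) ^ n * ∫ t, (derivative^[n] q).eval t * Real.exp (-1 * t ^ 2) := by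
  induction n generalizing q with
  | zero => simp [monicHermite]
  | succ n ih =>
    have hi (p : ℝ[X]) := p.integrable_eval_mul_exp_neg_mul_sq one_pos
    have h0 := integral_eq_zero_of_hasDerivAt_of_integrable
      (hasDerivAt_eval_mul_exp_neg_mul_sq (monicHermite n * q) 1) (hi _) (hi _)
    have h1 : ∀ t : ℝ, (derivative (monicHermite n * q) -
          C (2 * 1) * X * (monicHermite n * q)).eval t * Real.exp (-1 * t ^ 2) =
        (monicHermite n * derivative q).eval t * Real.exp (-1 * t ^ 2) -
          2 * ((monicHermite (n + 1) * q).eval t * Real.exp (-1 * t ^ 2)) := by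
      intro t
      simp [monicHermite]
      ring
    simp_rw [h1] at h0
    rw [integral_sub (hi _) ((hi _).const_mul 2), integral_const_mul, ih] at h0
    rw [Function.iterate_succ_apply, pow_succ]
    linarith

theorem integral_monicHermite_mul_of_natDegree_lt {n : ℕ} {q : ℝ[X]} (hq : q.natDegree < n) :
    ∫ t, (monicHermite n * q).eval t * Real.exp (-1 * t ^ 2) = 0 := by
  rw [integral_monicHermite_mul, iterate_derivative_eq_zero hq]
  simp

theorem integral_monicHermite_mul_self (n : ℕ) :
    ∫ t, (monicHermite n * monicHermite n).eval t * Real.exp (-1 * t ^ 2) =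
      √π * n.factorial / 2 ^ n := by
  obtain ⟨hm, hd⟩ := monic_monicHermite_and_natDegree n
  have h : derivative^[n] (monicHermite n) = C (n.factorial : ℝ) := by
    have h0 : (derivative^[n] (monicHermite n)).natDegree ≤ 0 := by
      simpa [hd] using natDegree_iterate_derivative (monicHermite n) n
    rw [eq_C_of_natDegree_le_zero h0, coeff_iterate_derivative, zero_add]
    have : (monicHermite n).coeff n = 1 := by simpa [hd] using hm.coeff_natDegree
    simp [this, Nat.descFactorial_self]
  rw [integral_monicHermite_mul, h]
  simp_rw [eval_C]
  rw [integral_const_mul, integral_gaussian]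
  simp
  ring

end Polynomial

open Polynomial in
theorem setIntegral_weylChamber_gaussian_eq {n : ℕ} (P : Fin n → ℝ[X])
    (hdeg : ∀ i, (P i).natDegree = i) (hmonic : ∀ i, (P i).Monic) :
    ∫ x in weylChamber n,
        Real.exp (-(∑ j, x j ^ 2) / 2) * ∏ j : Fin n, ∏ k ∈ Finset.Ioi j, (x k - x j) =
      ∫ x, vandermondeSign x * ∏ i, (P i).eval (x i) * Real.exp (-(1 / 2) * x i ^ 2) := by
  rw [← setIntegral_weylChamber_det (fun i t => (P i).eval t * Real.exp (-(1 / 2) * t ^ 2))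
    fun i => (P i).integrable_eval_mul_exp_neg_mul_sq one_half_pos]
  congr! 2 with x
  have hexp : Real.exp (-(∑ j, x j ^ 2) / 2) = ∏ j, Real.exp (-(1 / 2) * x j ^ 2) := by
    rw [← Real.exp_sum, ← Finset.mul_sum]
    ring_nf
  have hdet := Matrix.det_mul_row (fun j => Real.exp (-(1 / 2) * x j ^ 2))
    (Matrix.of fun i j => (P i).eval (x j))
  rw [← Matrix.det_vandermonde, Matrix.det_eval_matrixOfPolynomials_eq_det_vandermonde x P hdeg
    hmonic, hexp, ← Matrix.det_transpose]
  refine hdet.symm.trans ?_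
  simp [mul_comm]

open Polynomial in
theorem setIntegral_weylChamber_gaussian_add_two (n : ℕ) :
    ∫ x in weylChamber (n + 2),
        Real.exp (-(∑ j, x j ^ 2) / 2) * ∏ j : Fin (n + 2), ∏ k ∈ Finset.Ioi j, (x k - x j) =
      2 * (√π * n.factorial / 2 ^ n) * ∫ x in weylChamber n,
        Real.exp (-(∑ j, x j ^ 2) / 2) * ∏ j : Fin n, ∏ k ∈ Finset.Ioi j, (x k - x j) := by
  have hH := monic_monicHermite_and_natDegree
  have hQ := (hH n).1.X_mul_sub_C_mul_derivative 1
  rw [(hH n).2] at hQ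
  let P : Fin (n + 2) → ℝ[X] := Fin.snoc (fun i : Fin (n + 1) => monicHermite i)
    (X * monicHermite n - C 1 * derivative (monicHermite n))
  have hP_last : P (Fin.last _) = X * monicHermite n - C 1 * derivative (monicHermite n) :=
    Fin.snoc_last _ _
  have hP_castSucc (i : Fin (n + 1)) : P i.castSucc = monicHermite i :=
    Fin.snoc_castSucc (α := fun _ => ℝ[X]) _ _ i
  rw [setIntegral_weylChamber_gaussian_eq P
      (Fin.lastCases (by rw [hP_last, hQ.2]; rfl) fun i => by rw [hP_castSucc, (hH i).2]; rfl)
      (Fin.lastCases (by rw [hP_last]; exact hQ.1) fun i => by rw [hP_castSucc]; exact (hH i).1),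
    setIntegral_weylChamber_gaussian_eq (fun i : Fin n => monicHermite i) (fun i => (hH i).2)
      fun i => (hH i).1]
  have hi (p : ℝ[X]) := p.integrable_eval_mul_exp_neg_mul_sq one_half_pos
  have hmul (i : ℕ) (t : ℝ) : (monicHermite n).eval t * Real.exp (-(1 / 2) * t ^ 2) *
      ((monicHermite i).eval t * Real.exp (-(1 / 2) * t ^ 2)) =
      (monicHermite n * monicHermite i).eval t * Real.exp (-1 * t ^ 2) := by
    rw [eval_mul, mul_mul_mul_comm, ← Real.exp_add]
    ring_nf
  have h := integral_vandermondeSign_mul_prod_deriv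
    (fun i : Fin (n + 1) => fun t => (monicHermite i).eval t * Real.exp (-(1 / 2) * t ^ 2))
    (fun i => hi _) (hasDerivAt_eval_mul_exp_neg_mul_sq (monicHermite n) (1 / 2)) (hi _) (hi _)
    (fun i => by
      simp_rw [hmul]
      exact integrable_eval_mul_exp_neg_mul_sq _ one_pos)
  simp_rw [hmul] at h
  rw [Fin.sum_univ_castSucc, Finset.sum_eq_zero (fun i _ => by
    rw [integral_monicHermite_mul_of_natDegree_lt (by rw [(hH _).2]; exact i.2)]; simp),
    zero_add, Fin.val_last, integral_monicHermite_mul_self] at h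
  simp only [Fin.succAbove_last, Fin.val_castSucc] at h
  have hneg : ∀ x : Fin (n + 2) → ℝ,
      vandermondeSign x * ∏ i, (P i).eval (x i) * Real.exp (-(1 / 2) * x i ^ 2) =
      -(vandermondeSign x * ((derivative (monicHermite n) -
        C (2 * (1 / 2)) * X * monicHermite n).eval (x (Fin.last _)) *
          Real.exp (-(1 / 2) * x (Fin.last _) ^ 2) *
        ∏ i : Fin (n + 1), (monicHermite i).eval (x i.castSucc) *
          Real.exp (-(1 / 2) * x i.castSucc ^ 2))) := by
    intro x
    rw [Fin.prod_univ_castSucc, hP_last]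
    simp only [hP_castSucc]
    simp
    ring
  simp_rw [hneg]
  rw [integral_neg, h]
  have hsq : ((-1 : ℝ) ^ n) * (-1) ^ n = 1 := by rw [← mul_pow]; simp
  rw [pow_succ]
  linear_combination (2 * (√π * n.factorial / 2 ^ n) *
    ∫ x : Fin n → ℝ, vandermondeSign x *
      ∏ i : Fin n, (monicHermite i).eval (x i) * Real.exp (-(1 / 2) * x i ^ 2)) * hsq

theorem Real.Gamma_three_half_eq : Real.Gamma (3 / 2) = √π / 2 := by
  rw [show (3 / 2 : ℝ) = 1 / 2 + 1 by norm_num, Real.Gamma_add_one (by norm_num),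
    Real.Gamma_one_half_eq]
  ring

theorem goeConst_add_two (n : ℕ) :
    goeConst (n + 2) = 2 * (√π * n.factorial / 2 ^ n) * goeConst n := by
  have hdup := Real.Gamma_mul_Gamma_add_half (((n : ℝ) + 1) / 2 + 1)
  have h1 : 2 * (((n : ℝ) + 1) / 2 + 1) = ((n + 2 : ℕ) : ℝ) + 1 := by push_cast; ring
  have h2 : (2 : ℝ) ^ (1 - (((n + 2 : ℕ) : ℝ) + 1)) = (2 ^ (n + 2))⁻¹ := by
    rw [show (1 - (((n + 2 : ℕ) : ℝ) + 1)) = -((n + 2 : ℕ) : ℝ) by ring,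
      Real.rpow_neg (by norm_num), Real.rpow_natCast]
  rw [h1, Real.Gamma_nat_eq_factorial, h2] at hdup
  have h3 : (((n + 1 : ℕ) : ℝ) + 1) / 2 + 1 = ((n : ℝ) + 1) / 2 + 1 + 1 / 2 := by
    push_cast; ring
  have h4 : (2 * π) ^ (((n + 2 : ℕ) : ℝ) / 2) = (2 * π) ^ ((n : ℝ) / 2) * (2 * π) := by
    rw [show ((n + 2 : ℕ) : ℝ) / 2 = (n : ℝ) / 2 + 1 by push_cast; ring,
      Real.rpow_add_one (by positivity)]
  have hfac : ((n + 2).factorial : ℝ) ≠ 0 := by positivity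
  have hfac' : (n.factorial : ℝ) ≠ 0 := by positivity
  have hπ : √π * √π = π := Real.mul_self_sqrt pi_pos.le
  have hs : √π ≠ 0 := by positivity
  rw [goeConst, goeConst, Finset.prod_range_succ, Finset.prod_range_succ, h3, h4,
    Real.Gamma_three_half_eq, mul_assoc (∏ j ∈ Finset.range n, (_ : ℝ)), div_mul_div_comm, hdup]
  generalize ∏ j ∈ Finset.range n, (_ : ℝ) = R
  generalize (2 * π) ^ ((n : ℝ) / 2) = S
  generalize √π = r at hπ hs
  rw [← hπ]
  field_simp
  ring

/-- Normalization of the GOE eigenvalue density (σ² = 1):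
`∫_{W_N^A} e^{-|x|²/2} ∏_{j<k}(x_k - x_j) dx = C_N^{(1)}`. -/
theorem goe_normalization (N : ℕ) :
    ∫ x in weylChamber N,
        Real.exp (-(∑ j, x j ^ 2) / 2) * ∏ j : Fin N, ∏ k ∈ Finset.Ioi j, (x k - x j)
      = goeConst N := by
  induction N using Nat.twoStepInduction with
  | zero =>
    rw [setIntegral_weylChamber_gaussian_eq Fin.elim0 (fun i => i.elim0) fun i => i.elim0]
    simp [vandermondeSign, goeConst, Measure.real, volume_pi]
  | one =>
    rw [setIntegral_weylChamber_gaussian_eq (fun _ => 1) (by simp) (by simp)]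
    have h := integral_fintype_prod_volume_eq_prod
      (fun (_ : Fin 1) (t : ℝ) => Real.exp (-(1 / 2) * t ^ 2))
    rw [Fin.prod_univ_one, integral_gaussian] at h
    have hΓ : Real.Gamma (3 / 2) ≠ 0 := (Real.Gamma_pos_of_pos (by norm_num)).ne'
    have hconst : goeConst 1 = √(2 * π) := by
      rw [Real.sqrt_eq_rpow, goeConst, Finset.prod_range_one,
        show (((0 : ℕ) : ℝ) + 1) / 2 + 1 = 3 / 2 by norm_num, div_self hΓ]
      simp
    have hsign : ∀ x : Fin 1 → ℝ, vandermondeSign x = 1 := fun x =>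
      vandermondeSign_of_strictMono (Subsingleton.strictMono x)
    simp only [hsign, Polynomial.eval_one, one_mul]
    rw [h, hconst, div_eq_mul_inv, one_div, inv_inv, mul_comm]
  | more n ih _ => rw [setIntegral_weylChamber_gaussian_add_two, ih, goeConst_add_two]
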